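/- arXiv:2102.07184 — 2 statements merged into one kernel-verified Lean document; each statement's English description precedes it below -/
import Mathlib

section
/- For every integer k ≥ 3, Σ_{j=2}^{k−1} (2^{j−1}−1) ζ^{(2)}(j, \overline{k−j}) + Σ_{j=2}^{k−1} (2^{j−1}−1) ζ^{(2)}(\overline{j}, \overline{k−j}) − Σ_{j=2}^{k−1} ζ^{(2)}(\overline{j}, k−j) = (k−2) ζ^{(2)}(\overline{k}). -/
/-- `altDoubleZeta a b j l = Σ_{m>n>0} (-1)^(a·m + b·n)/(m^j n^l)`: for `a,b ∈ {0,1}` these are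
the (alternating) double zeta values of level 2; a bar on an entry corresponds to sign `1`. -/
noncomputable def altDoubleZeta (a b : ℕ) (j l : ℕ) : ℝ :=
  ∑' p : {p : ℕ × ℕ // p.2 < p.1 ∧ 0 < p.2},
    (-1 : ℝ) ^ (a * p.1.1 + b * p.1.2) / ((p.1.1 : ℝ) ^ j * (p.1.2 : ℝ) ^ l)

/-- ;  and
. -/
noncomputable def altSingleZeta (a : ℕ) (k : ℕ) : ℝ :=
  ∑' m : {m : ℕ // 0 < m}, (-1 : ℝ) ^ (a * m.1) / (m.1 : ℝ) ^ k


section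

open Finset

lemma summable_one_div_mul_mul_add :
    Summable fun p : ℕ × ℕ => 1 / ((p.1 : ℝ) * p.2 * (p.1 + p.2)) := by
  have h : Summable fun n : ℕ => 1 / (n : ℝ) ^ (3 / 2 : ℝ) :=
    Real.summable_one_div_nat_rpow.2 (by norm_num)
  refine Summable.of_nonneg_of_le (fun p => by positivity) (fun p => ?_)
    (h.mul_of_nonneg h (fun n => by positivity) (fun n => by positivity))
  obtain ⟨m, n⟩ := p
  rcases Nat.eq_zero_or_pos m with rfl | hm
  · simp
  rcases Nat.eq_zero_or_pos n with rfl | hn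
  · simp
  have key (x : ℕ) : (x : ℝ) ^ (3 / 2 : ℝ) = x * √x := by
    rcases Nat.eq_zero_or_pos x with rfl | hx
    · norm_num
    rw [show (3 / 2 : ℝ) = 1 + 1 / 2 by norm_num, Real.rpow_add (by positivity), Real.rpow_one,
      Real.sqrt_eq_rpow]
  simp only [key]
  rw [div_mul_div_comm, one_mul]
  apply one_div_le_one_div_of_le (by positivity)
  have h1 := Real.sq_sqrt (Nat.cast_nonneg (α := ℝ) m)
  have h2 := Real.sq_sqrt (Nat.cast_nonneg (α := ℝ) n)
  have h3 : √(m : ℝ) * √n ≤ m + n := by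
    nlinarith [sq_nonneg (√(m : ℝ) - √n), sq_nonneg (√(m : ℝ) + √n)]
  calc (m : ℝ) * √m * (n * √n) = m * n * (√m * √n) := by ring
    _ ≤ _ := by gcongr

lemma summable_one_div_mul_sub_mul :
    Summable fun p : ℕ × ℕ =>
      if p.1 < p.2 then 1 / ((p.1 : ℝ) * (p.2 - p.1) * p.2) else 0 := by
  have hinj : Function.Injective fun p : ℕ × ℕ => (p.1, p.1 + p.2) := by
    rintro ⟨a, b⟩ ⟨c, d⟩ h
    simp only [Prod.mk.injEq] at h ⊢
    lia
  rw [← hinj.summable_iff]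
  · refine summable_one_div_mul_mul_add.congr fun p => ?_
    obtain ⟨m, d⟩ := p
    rcases Nat.eq_zero_or_pos d with rfl | hd
    · simp
    · simp [hd]
  · rintro ⟨a, b⟩ h
    rw [if_neg]
    intro hab
    exact h ⟨(a, b - a), by simp only [Prod.mk.injEq]; lia⟩

lemma summable_mul_one_div_pow_mul_pow {j l : ℕ} (hj : 2 ≤ j) (hl : 1 ≤ l) {c : ℕ → ℕ → ℝ} {C : ℝ}
    (hc : ∀ m n, |c m n| ≤ C) (hs : ∀ m n, 2 * m ≤ n → c m n = 0) :
    Summable fun p : ℕ × ℕ => c p.1 p.2 / ((p.1 : ℝ) ^ j * (p.2 : ℝ) ^ l) := by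
  refine Summable.of_norm_bounded (summable_one_div_mul_mul_add.mul_left (3 * C)) ?_
  rintro ⟨m, n⟩
  have hC : 0 ≤ C := (abs_nonneg _).trans (hc 0 0)
  rcases Nat.eq_zero_or_pos m with rfl | hm
  · simp [show j ≠ 0 by lia]
  rcases Nat.eq_zero_or_pos n with rfl | hn
  · simp [show l ≠ 0 by lia]
  dsimp only
  rcases le_or_gt (2 * m) n with h | h
  · rw [hs m n h]; simp; positivity
  have hm1 : (1 : ℝ) ≤ m := by exact_mod_cast hm
  have hn1 : (1 : ℝ) ≤ n := by exact_mod_cast hn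
  have hnm : (n : ℝ) ≤ 2 * m := by exact_mod_cast h.le
  rw [Real.norm_eq_abs, abs_div, abs_of_pos (show (0 : ℝ) < (m : ℝ) ^ j * (n : ℝ) ^ l by positivity)]
  calc |c m n| / ((m : ℝ) ^ j * (n : ℝ) ^ l) ≤ C / ((m : ℝ) ^ 2 * (n : ℝ) ^ 1) := by
        gcongr
        exact hc m n
    _ ≤ _ := by
        rw [mul_one_div, div_le_div_iff₀ (by positivity) (by positivity)]
        have : C * (m * n) * (m + n) ≤ C * (m * n) * (3 * m) := by gcongr; linarith
        nlinarith

lemma sum_Icc_one_div_pow_mul_pow (s : ℕ) {x y : ℝ} (hx : x ≠ 0) (hy : y ≠ 0) (hxy : x ≠ y) :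
    ∑ j ∈ Icc 2 (s + 1), 1 / (x ^ j * y ^ (s + 2 - j)) =
      1 / (x * (x - y)) * (1 / y ^ s - 1 / x ^ s) := by
  have hd : x - y ≠ 0 := sub_ne_zero.2 hxy
  induction s with
  | zero => simp
  | succ s ih =>
    rw [Finset.sum_Icc_succ_top (by lia)]
    have : ∑ j ∈ Icc 2 (s + 1), 1 / (x ^ j * y ^ (s + 1 + 2 - j)) =
        1 / y * ∑ j ∈ Icc 2 (s + 1), 1 / (x ^ j * y ^ (s + 2 - j)) := by
      rw [mul_sum]
      refine sum_congr rfl fun j hj => ?_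
      rw [mem_Icc] at hj
      rw [show s + 1 + 2 - j = (s + 2 - j) + 1 by lia, pow_succ]
      field_simp
    rw [this, ih, show s + 1 + 2 - (s + 1 + 1) = 1 by lia]
    field_simp
    ring

lemma hasSum_altDoubleZeta (a b : ℕ) {j l : ℕ} (hj : 2 ≤ j) (hl : 1 ≤ l) :
    HasSum (fun p : ℕ × ℕ => (if p.2 < p.1 then (-1 : ℝ) ^ (a * p.1 + b * p.2) else 0) /
      ((p.1 : ℝ) ^ j * (p.2 : ℝ) ^ l)) (altDoubleZeta a b j l) := by
  have h : Summable (fun p : ℕ × ℕ => (if p.2 < p.1 then (-1 : ℝ) ^ (a * p.1 + b * p.2) else 0) /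
      ((p.1 : ℝ) ^ j * (p.2 : ℝ) ^ l)) := by
    refine summable_mul_one_div_pow_mul_pow hj hl
      (c := fun m n => if n < m then (-1 : ℝ) ^ (a * m + b * n) else 0) (C := 1) ?_ ?_
    · intro m n
      split_ifs <;> simp
    · intro m n h
      rw [if_neg (by lia)]
  convert h.hasSum using 1
  refine (tsum_subtype {p : ℕ × ℕ | p.2 < p.1 ∧ 0 < p.2} fun p : ℕ × ℕ =>
    (-1 : ℝ) ^ (a * p.1 + b * p.2) / ((p.1 : ℝ) ^ j * (p.2 : ℝ) ^ l)).trans (tsum_congr ?_)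
  rintro ⟨m, n⟩
  rcases Nat.eq_zero_or_pos n with rfl | hn
  · simp [show l ≠ 0 by lia]
  · by_cases hmn : n < m <;> simp [Set.indicator, hn, hmn]

lemma hasSum_diagonal {k : ℕ} (hk : 2 ≤ k) (c : ℝ) :
    HasSum (fun p : ℕ × ℕ => if p.1 = p.2 then (-1 : ℝ) ^ p.2 * (c / (p.1 : ℝ) ^ k) else 0)
      (c * altSingleZeta 1 k) := by
  have hinj : Function.Injective fun n : ℕ => (n, n) := fun a b h => (Prod.mk.inj h).1
  rw [← hinj.hasSum_iff]
  · have h : Summable fun n : ℕ => (-1 : ℝ) ^ n / (n : ℝ) ^ k := by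
      refine Summable.of_norm_bounded (Real.summable_one_div_nat_pow.2 (show 1 < k by lia)) ?_
      intro n
      simp
    have h1 : altSingleZeta 1 k = ∑' n : ℕ, (-1 : ℝ) ^ n / (n : ℝ) ^ k := by
      refine (tsum_subtype {m : ℕ | 0 < m} fun m : ℕ => (-1 : ℝ) ^ (1 * m) / (m : ℝ) ^ k).trans
        (tsum_congr fun n => ?_)
      rcases Nat.eq_zero_or_pos n with rfl | hn
      · simp [show k ≠ 0 by lia]
      · simp [Set.indicator, hn]
    rw [h1]
    refine (h.hasSum.mul_left c).congr_fun fun n => ?_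
    simp only [Function.comp_apply, if_true]
    ring
  · rintro ⟨a, b⟩ h
    rw [if_neg]
    rintro hab
    exact h ⟨a, by simpa using hab⟩

lemma hasSum_weighted_altDoubleZeta {j l : ℕ} (hj : 2 ≤ j) (hl : 1 ≤ l) :
    HasSum (fun p : ℕ × ℕ => ((if p.2 < 2 * p.1 then (-1 : ℝ) ^ p.2 else 0) -
        if p.2 < p.1 then (1 + (-1 : ℝ) ^ p.1) * (-1) ^ p.2 + (-1) ^ p.1 else 0) *
        (1 / ((p.1 : ℝ) ^ j * (p.2 : ℝ) ^ l)))
      ((2 ^ (j - 1) - 1) * altDoubleZeta 0 1 j l + (2 ^ (j - 1) - 1) * altDoubleZeta 1 1 j l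
        - altDoubleZeta 1 0 j l) := by
  have h01 := hasSum_altDoubleZeta 0 1 hj hl
  have h11 := hasSum_altDoubleZeta 1 1 hj hl
  have h10 := hasSum_altDoubleZeta 1 0 hj hl
  have hinj : Function.Injective fun p : ℕ × ℕ => (2 * p.1, p.2) := by
    rintro ⟨a, b⟩ ⟨c, d⟩ h
    simp only [Prod.mk.injEq] at h ⊢
    lia
  have h2 := ((hinj.hasSum_iff ?_).2 (h01.add h11)).mul_left ((2 : ℝ) ^ (j - 1))
  · have h3 := (h2.sub (h01.add h11)).sub h10
    rw [show ∀ a b c d : ℝ, a * (b + c) - (b + c) - d = (a - 1) * b + (a - 1) * c - d by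
      intros; ring] at h3
    refine h3.congr_fun ?_
    · rintro ⟨m, n⟩
      obtain ⟨i, rfl⟩ : ∃ i, j = i + 1 := ⟨j - 1, by lia⟩
      have e : (2 : ℝ) ^ i * ((1 + 1) * (-1) ^ n / ((2 * m : ℝ) ^ (i + 1) * n ^ l)) =
          (-1) ^ n * (1 / ((m : ℝ) ^ (i + 1) * n ^ l)) := by
        rw [mul_pow, pow_succ (2 : ℝ)]
        have : (2 : ℝ) ^ i ≠ 0 := by positivity
        field_simp
        ring
      by_cases h1 : n < 2 * m <;> by_cases h3 : n < m <;>
        simp [h1, h3, pow_add, pow_mul] at e ⊢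
      pick_goal 3
      · lia
      · linear_combination -e
      · linear_combination -e
  · rintro ⟨m, n⟩ h
    have hm : Odd m := by
      rw [← Nat.not_even_iff_odd]
      rintro ⟨a, ha⟩
      exact h ⟨(a, n), by simp only [Prod.mk.injEq]; lia⟩
    by_cases hmn : n < m
    · simp [hmn, pow_add, hm.neg_one_pow, neg_div]
    · simp [hmn]

lemma tendsto_sum_neg_one_pow_div_sub {N : ℕ} (hN : Even N) :
    Filter.Tendsto (fun D => ∑ d ∈ range D, ((-1 : ℝ) ^ d / d - (-1) ^ d / ((d + N : ℕ) : ℝ)))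
      Filter.atTop (nhds (∑ d ∈ range N, (-1 : ℝ) ^ d / d)) := by
  set g : ℕ → ℝ := fun d => (-1) ^ d / d with hg
  have hg0 : Filter.Tendsto g Filter.atTop (nhds 0) := by
    rw [tendsto_zero_iff_norm_tendsto_zero]
    simpa [hg] using tendsto_inv_atTop_nhds_zero_nat (𝕜 := ℝ)
  have h1 : Filter.Tendsto (fun D => ∑ d ∈ range N, g d - ∑ d ∈ range N, g (D + d)) Filter.atTop
      (nhds (∑ d ∈ range N, g d - ∑ d ∈ range N, 0)) := by
    refine tendsto_const_nhds.sub (tendsto_finsetSum _ fun d _ => ?_)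
    exact hg0.comp (Filter.tendsto_add_atTop_nat d)
  simp only [sum_const_zero, sub_zero] at h1
  refine h1.congr fun D => ?_
  have h2 := sum_range_add g D N
  have h3 := sum_range_add g N D
  rw [add_comm N D] at h3
  have h4 : ∑ d ∈ range D, (g d - (-1) ^ d / ((d + N : ℕ) : ℝ)) =
      ∑ d ∈ range D, g d - ∑ d ∈ range D, g (N + d) := by
    rw [sum_sub_distrib]
    congr 1
    refine sum_congr rfl fun d _ => ?_
    simp [hg, pow_add, hN.neg_one_pow, add_comm]
  rw [h4]
  linarith

lemma hasSum_neg_one_pow_div_mul_sub (N : ℕ) :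
    HasSum (fun x : ℕ => if N < x ∧ x < 2 * N then (-1 : ℝ) ^ x / (N * (x - N)) else 0)
      ((-1) ^ N / N * ∑ d ∈ range N, (-1 : ℝ) ^ d / d) := by
  have h : HasSum _ _ := hasSum_sum_of_ne_finset_zero (s := Ico N (N + N))
    (f := fun x : ℕ => if N < x ∧ x < 2 * N then (-1 : ℝ) ^ x / (N * (x - N)) else 0) ?_
  · convert h using 1
    rw [sum_Ico_eq_sum_range, mul_sum, Nat.add_sub_cancel]
    refine sum_congr rfl fun d hd => ?_
    rw [mem_range] at hd
    rcases Nat.eq_zero_or_pos d with rfl | hd0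
    · simp
    rw [if_pos (by lia), div_mul_div_comm, pow_add]
    push_cast
    simp
  · intro x hx
    rw [mem_Ico] at hx
    rw [if_neg (by lia)]

lemma sum_Ico_ite_two_mul_eq {N : ℕ} (hN : 0 < N) :
    ∑ x ∈ Ico 1 N, (if 2 * x = N then 1 / (x : ℝ) else 0) = (1 + (-1) ^ N) / N := by
  rcases Nat.even_or_odd' N with ⟨h, rfl | rfl⟩
  · rw [sum_eq_single_of_mem h (by rw [mem_Ico]; lia) fun b _ hb => if_neg (by lia)]
    have : (h : ℝ) ≠ 0 := by simp; lia
    rw [if_pos rfl, pow_mul]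
    push_cast
    field_simp
    norm_num
  · rw [sum_eq_zero fun x _ => if_neg (by lia)]
    simp [pow_succ]

lemma sum_Ico_ite_one_div_add_one_div_sub {N : ℕ} (hN : 0 < N) :
    ∑ x ∈ Ico 1 N, (if N < 2 * x then 1 / (x : ℝ) + 1 / ((N : ℝ) - x) else 0) =
      ∑ x ∈ Ico 1 N, 1 / (x : ℝ) - (1 + (-1) ^ N) / N := by
  have h : ∑ x ∈ Ico 1 N, (if N < 2 * x then 1 / ((N : ℝ) - x) else 0) =
      ∑ x ∈ Ico 1 N, (if 2 * x < N then 1 / (x : ℝ) else 0) := by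
    refine sum_nbij' (fun x => N - x) (fun x => N - x) ?_ ?_ ?_ ?_ ?_ <;> intro x hx <;>
      rw [mem_Ico] at hx
    · rw [mem_Ico]; lia
    · rw [mem_Ico]; lia
    · lia
    · lia
    · rw [Nat.cast_sub hx.2.le]
      exact if_congr (by lia) rfl rfl
  rw [← sum_Ico_ite_two_mul_eq hN]
  trans ∑ x ∈ Ico 1 N, (if N < 2 * x then 1 / (x : ℝ) else 0) +
    ∑ x ∈ Ico 1 N, (if 2 * x < N then 1 / (x : ℝ) else 0)
  · rw [← h, ← sum_add_distrib]
    refine sum_congr rfl fun x _ => ?_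
    split_ifs <;> simp
  · rw [← sum_add_distrib, ← sum_sub_distrib]
    refine sum_congr rfl fun x _ => ?_
    rcases lt_trichotomy (2 * x) N with h | h | h
    · rw [if_neg (by lia), if_pos h, if_neg h.ne]; ring
    · rw [if_neg (by lia), if_neg (by lia), if_pos h]; ring
    · rw [if_pos h, if_neg (by lia), if_neg h.ne']; ring

lemma sum_Ico_one_eq_sum_range {f : ℕ → ℝ} (hf : f 0 = 0) (N : ℕ) :
    ∑ x ∈ Ico 1 N, f x = ∑ x ∈ range N, f x := by
  rw [range_eq_Ico]
  refine sum_subset (Ico_subset_Ico_left zero_le_one) fun x hx hx' => ?_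
  rw [mem_Ico] at hx hx'
  rw [show x = 0 by lia, hf]

lemma hasSum_neg_one_pow_div_mul_sub' {N : ℕ} (hN : 0 < N) :
    HasSum (fun x : ℕ => if x < N ∧ N < 2 * x then (-1 : ℝ) ^ N / (x * (N - x)) else 0)
      ((-1) ^ N / N * (∑ d ∈ range N, 1 / (d : ℝ) - (1 + (-1) ^ N) / N)) := by
  have h : HasSum _ _ := hasSum_sum_of_ne_finset_zero (s := Ico 1 N)
    (f := fun x : ℕ => if x < N ∧ N < 2 * x then (-1 : ℝ) ^ N / (x * (N - x)) else 0) ?_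
  · convert h using 1
    rw [← sum_Ico_one_eq_sum_range (by simp), ← sum_Ico_ite_one_div_add_one_div_sub hN, mul_sum]
    refine sum_congr rfl fun x hx => ?_
    rw [mem_Ico] at hx
    by_cases hx2 : N < 2 * x
    · have h1 : (x : ℝ) ≠ 0 := by simp; lia
      have h2 : (N : ℝ) ≠ 0 := by simp; lia
      have h3 : (N : ℝ) - x ≠ 0 := sub_ne_zero.2 (by simp; lia)
      rw [if_pos hx2, if_pos ⟨hx.2, hx2⟩]
      field_simp
      ring
    · simp [hx2]
  · intro x hx
    rw [mem_Ico] at hx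
    rw [if_neg (by lia)]

lemma hasSum_neg_one_pow_mul_div_mul_sub {N : ℕ} :
    HasSum (fun x : ℕ => if 0 < x ∧ x < N then
        (-1 : ℝ) ^ N * ((-1) ^ x + 1) / (N * (N - x)) else 0)
      (1 / N * ∑ d ∈ range N, ((-1 : ℝ) ^ d + (-1) ^ N) / d) := by
  have h : HasSum _ _ := hasSum_sum_of_ne_finset_zero (s := Ico 1 N)
    (f := fun x : ℕ => if 0 < x ∧ x < N then
        (-1 : ℝ) ^ N * ((-1) ^ x + 1) / (N * (N - x)) else 0) ?_
  · convert h using 1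
    rw [← sum_Ico_one_eq_sum_range (by simp), mul_sum]
    refine sum_nbij' (fun x => N - x) (fun x => N - x) ?_ ?_ ?_ ?_ ?_ <;> intro x hx <;>
      rw [mem_Ico] at hx
    · rw [mem_Ico]; lia
    · rw [mem_Ico]; lia
    · lia
    · lia
    · obtain ⟨y, rfl⟩ := Nat.exists_eq_add_of_lt hx.2
      rw [if_pos (by lia), Nat.cast_sub hx.2.le, sub_sub_cancel, div_mul_div_comm, one_mul,
        show x + y + 1 - x = y + 1 by lia, show x + y + 1 = x + (y + 1) by lia, pow_add]
      congr 1
      have := pow_mul_pow_eq_one (y + 1) (show (-1 : ℝ) * -1 = 1 by norm_num)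
      linear_combination - (-1) ^ x * this
  · intro x hx
    rw [mem_Ico] at hx
    rw [if_neg (by lia)]

lemma hasSum_neg_one_pow_mul_div_mul_sub_of_summable {N : ℕ} (hN : 0 < N)
    (h : Summable fun x : ℕ => if N < x then
        (-1 : ℝ) ^ x * ((-1) ^ N + 1) / (x * (x - N)) else 0) :
    HasSum (fun x : ℕ => if N < x then
        (-1 : ℝ) ^ x * ((-1) ^ N + 1) / (x * (x - N)) else 0)
      (((-1) ^ N + 1) / N * (∑ d ∈ range N, (-1 : ℝ) ^ d / d + 1 / N)) := by
  rcases Nat.even_or_odd N with hE | hO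
  · convert h.hasSum using 1
    have hN0 : (N : ℝ) ≠ 0 := by simp; lia
    rw [← h.sum_add_tsum_nat_add N, sum_eq_zero fun x hx => if_neg (by rw [mem_range] at hx; lia),
      zero_add]
    have h' := ((summable_nat_add_iff N).2 h).hasSum.tendsto_sum_nat
    refine tendsto_nhds_unique ?_ h'
    have h2 := (((tendsto_sum_neg_one_pow_div_sub hE).add_const (1 / (N : ℝ))).const_mul
      (((-1 : ℝ) ^ N + 1) / N))
    refine h2.congr' ?_
    filter_upwards [Filter.eventually_gt_atTop 0] with D hD
    obtain ⟨D, rfl⟩ : ∃ E, D = E + 1 := ⟨D - 1, by lia⟩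
    rw [sum_range_succ', sum_range_succ']
    simp only [hE.neg_one_pow]
    have : ∀ d : ℕ, (if N < d + 1 + N then
        (-1 : ℝ) ^ (d + 1 + N) * (1 + 1) / (((d + 1 + N : ℕ) : ℝ) * (((d + 1 + N : ℕ) : ℝ) - N))
          else 0) = (1 + 1) / N *
          ((-1) ^ (d + 1) / ((d + 1 : ℕ) : ℝ) - (-1) ^ (d + 1) / ((d + 1 + N : ℕ) : ℝ)) := by
      intro d
      rw [if_pos (by lia), pow_add _ _ N, hE.neg_one_pow]
      push_cast
      have h1 : (d : ℝ) + 1 ≠ 0 := by positivity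
      have h2 : (d : ℝ) + 1 + N ≠ 0 := by positivity
      rw [add_sub_cancel_right]
      field_simp
      ring
    simp only [this, ← mul_sum]
    simp
  · simp [hO.neg_one_pow]

lemma abs_div_mul_sub_div_pow_le {a b y z s : ℕ} {c : ℝ} (hc : |c| ≤ 2) (ha : 0 < a) (hab : a < b)
    (hy : 0 < y) (hz : 0 < z) (h : a * b ≤ 2 * (z * y)) (hs : 1 ≤ s) :
    |c / (z * ((b : ℝ) - a)) / (y : ℝ) ^ s| ≤ 4 * (1 / ((a : ℝ) * (b - a) * b)) := by
  have hd : (0 : ℝ) < b - a := sub_pos.2 (by exact_mod_cast hab)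
  have hy1 : (1 : ℝ) ≤ y := by exact_mod_cast hy
  have hz' : (0 : ℝ) < z := by exact_mod_cast hz
  have ha' : (0 : ℝ) < a := by exact_mod_cast ha
  have hb' : (0 : ℝ) < b := by exact_mod_cast ha.trans hab
  have h' : (a : ℝ) * b ≤ 2 * (z * y) := by exact_mod_cast h
  rw [div_div, abs_div, abs_of_pos (show (0 : ℝ) < z * ((b : ℝ) - a) * (y : ℝ) ^ s by positivity)]
  calc |c| / (z * ((b : ℝ) - a) * (y : ℝ) ^ s) ≤ 2 / (z * ((b : ℝ) - a) * (y : ℝ) ^ 1) := by gcongr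
    _ ≤ _ := by
      rw [mul_one_div, div_le_div_iff₀ (by positivity) (by positivity)]
      nlinarith [mul_le_mul_of_nonneg_left h' hd.le]

lemma summable_of_abs_le_one_div_mul_sub_mul {f : ℕ × ℕ → ℝ} (h0 : ∀ p, ¬p.1 < p.2 → f p = 0)
    (h1 : ∀ n, f (0, n) = 0)
    (h : ∀ p : ℕ × ℕ, 0 < p.1 → p.1 < p.2 → |f p| ≤ 4 * (1 / ((p.1 : ℝ) * (p.2 - p.1) * p.2))) :
    Summable f := by
  refine Summable.of_norm_bounded (summable_one_div_mul_sub_mul.mul_left 4) ?_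
  rintro ⟨m, n⟩
  rcases Nat.eq_zero_or_pos m with rfl | hm
  · rw [h1]; simp
  by_cases hmn : m < n
  · rw [if_pos hmn]
    exact h (m, n) hm hmn
  · rw [h0 _ hmn, if_neg hmn]; simp

lemma summable_lt_two_mul_div_fst_pow {s : ℕ} (hs : 1 ≤ s) :
    Summable fun p : ℕ × ℕ => (if p.1 < p.2 ∧ p.2 < 2 * p.1 then
      (-1 : ℝ) ^ p.2 / (p.1 * (p.2 - p.1)) else 0) / (p.1 : ℝ) ^ s := by
  refine summable_of_abs_le_one_div_mul_sub_mul (fun p hp => by simp [hp]) (by simp) ?_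
  rintro ⟨a, b⟩ ha hab
  dsimp only at ha hab ⊢
  by_cases h : b < 2 * a
  · rw [if_pos ⟨hab, h⟩]
    exact abs_div_mul_sub_div_pow_le (by simp) ha hab ha ha (by nlinarith) hs
  · have : (0 : ℝ) < b - a := sub_pos.2 (by exact_mod_cast hab)
    simp only [h, and_false, if_false, zero_div, abs_zero]
    positivity

lemma summable_lt_two_mul_div_snd_pow {s : ℕ} (hs : 1 ≤ s) :
    Summable fun p : ℕ × ℕ => (if p.1 < p.2 ∧ p.2 < 2 * p.1 then
      (-1 : ℝ) ^ p.2 / (p.1 * (p.2 - p.1)) else 0) / (p.2 : ℝ) ^ s := by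
  refine summable_of_abs_le_one_div_mul_sub_mul (fun p hp => by simp [hp]) (by simp) ?_
  rintro ⟨a, b⟩ ha hab
  dsimp only at ha hab ⊢
  by_cases h : b < 2 * a
  · rw [if_pos ⟨hab, h⟩]
    exact abs_div_mul_sub_div_pow_le (by simp) ha hab (ha.trans hab) ha (by nlinarith) hs
  · have : (0 : ℝ) < b - a := sub_pos.2 (by exact_mod_cast hab)
    simp only [h, and_false, if_false, zero_div, abs_zero]
    positivity

lemma abs_neg_one_pow_mul_le_two (m n : ℕ) : |(-1 : ℝ) ^ m * ((-1) ^ n + 1)| ≤ 2 := by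
  rcases neg_one_pow_eq_or ℝ m with h | h <;> rcases neg_one_pow_eq_or ℝ n with h' | h' <;>
    rw [h, h'] <;> norm_num

lemma summable_lt_div_fst_pow {s : ℕ} (hs : 1 ≤ s) :
    Summable fun p : ℕ × ℕ => (if p.1 < p.2 then
      (-1 : ℝ) ^ p.2 * ((-1) ^ p.1 + 1) / (p.2 * (p.2 - p.1)) else 0) / (p.1 : ℝ) ^ s := by
  refine summable_of_abs_le_one_div_mul_sub_mul (fun p hp => by simp [hp])
    (by simp [show s ≠ 0 by lia]) ?_
  rintro ⟨a, b⟩ ha hab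
  dsimp only at ha hab ⊢
  rw [if_pos hab]
  exact abs_div_mul_sub_div_pow_le (abs_neg_one_pow_mul_le_two _ _) ha hab ha (ha.trans hab)
    (by nlinarith) hs

lemma summable_pos_lt_div_snd_pow {s : ℕ} (hs : 1 ≤ s) :
    Summable fun p : ℕ × ℕ => (if 0 < p.1 ∧ p.1 < p.2 then
      (-1 : ℝ) ^ p.2 * ((-1) ^ p.1 + 1) / (p.2 * (p.2 - p.1)) else 0) / (p.2 : ℝ) ^ s := by
  refine summable_of_abs_le_one_div_mul_sub_mul (fun p hp => by simp [hp]) (by simp) ?_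
  rintro ⟨a, b⟩ ha hab
  dsimp only at ha hab ⊢
  rw [if_pos ⟨ha, hab⟩]
  exact abs_div_mul_sub_div_pow_le (abs_neg_one_pow_mul_le_two _ _) ha hab (ha.trans hab)
    (ha.trans hab) (by nlinarith) hs

lemma hasSum_off_diagonal {s : ℕ} (hs : 1 ≤ s) :
    HasSum (fun p : ℕ × ℕ =>
      (if p.1 < p.2 ∧ p.2 < 2 * p.1 then
        (-1 : ℝ) ^ p.2 / (p.1 * (p.2 - p.1)) else 0) / (p.1 : ℝ) ^ s
      - (if p.1 < p.2 ∧ p.2 < 2 * p.1 then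
        (-1 : ℝ) ^ p.2 / (p.1 * (p.2 - p.1)) else 0) / (p.2 : ℝ) ^ s
      - (if p.2 < p.1 then
        (-1 : ℝ) ^ p.1 * ((-1) ^ p.2 + 1) / (p.1 * (p.1 - p.2)) else 0) / (p.2 : ℝ) ^ s
      + (if 0 < p.2 ∧ p.2 < p.1 then
        (-1 : ℝ) ^ p.1 * ((-1) ^ p.2 + 1) / (p.1 * (p.1 - p.2)) else 0) / (p.1 : ℝ) ^ s) 0 := by
  have s1 := summable_lt_two_mul_div_fst_pow hs
  have s2 := summable_lt_two_mul_div_snd_pow hs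
  have s3 := summable_lt_div_fst_pow hs
  have s4 := summable_pos_lt_div_snd_pow hs
  have s2' := s2.prod_symm
  have s4' := s4.prod_symm
  have s3' := s3.prod_symm
  have key := ((s1.sub s2').sub s3).add s4'
  have h0 : ∑' p, _ = (0 : ℝ) := key.tsum_prod.trans <| by
    refine (tsum_congr fun N => ?_).trans tsum_zero
    rcases Nat.eq_zero_or_pos N with rfl | hN
    · simp [show s ≠ 0 by lia]
    have hN0 : (N : ℝ) ^ s ≠ 0 := by positivity
    have f3 : Summable fun x : ℕ => if N < x then
        (-1 : ℝ) ^ x * ((-1) ^ N + 1) / (x * (x - N)) else 0 := by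
      refine ((s3.prod_factor N).mul_right ((N : ℝ) ^ s)).congr fun x => ?_
      exact div_mul_cancel₀ _ hN0
    have h1 := (hasSum_neg_one_pow_div_mul_sub N).div_const ((N : ℝ) ^ s)
    have h2 := (hasSum_neg_one_pow_div_mul_sub' hN).div_const ((N : ℝ) ^ s)
    have h3 := (hasSum_neg_one_pow_mul_div_mul_sub_of_summable hN f3).div_const ((N : ℝ) ^ s)
    have h4 := (hasSum_neg_one_pow_mul_div_mul_sub (N := N)).div_const ((N : ℝ) ^ s)
    refine (((h1.sub h2).sub h3).add h4).tsum_eq.trans ?_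
    have e : ((-1 : ℝ) ^ N) ^ 2 = 1 := by rw [← pow_mul, mul_comm, pow_mul]; simp
    have e2 : ∑ d ∈ range N, ((-1 : ℝ) ^ d + (-1) ^ N) / d =
        ∑ d ∈ range N, (-1 : ℝ) ^ d / d + (-1) ^ N * ∑ d ∈ range N, 1 / (d : ℝ) := by
      rw [mul_sum, ← sum_add_distrib]
      refine sum_congr rfl fun d _ => by ring
    rw [e2]
    have hN1 : (N : ℝ) ≠ 0 := by positivity
    field_simp
    linear_combination e
  have t2 := (Equiv.prodComm ℕ ℕ).tsum_eq (fun p : ℕ × ℕ => (if p.1 < p.2 ∧ p.2 < 2 * p.1 then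
      (-1 : ℝ) ^ p.2 / (p.1 * (p.2 - p.1)) else 0) / (p.2 : ℝ) ^ s)
  have t3 := (Equiv.prodComm ℕ ℕ).tsum_eq (fun p : ℕ × ℕ => (if p.1 < p.2 then
      (-1 : ℝ) ^ p.2 * ((-1) ^ p.1 + 1) / (p.2 * (p.2 - p.1)) else 0) / (p.1 : ℝ) ^ s)
  have h1 := (((s1.hasSum.sub s2'.hasSum).sub s3.hasSum).add s4'.hasSum).tsum_eq
  have h2 := ((s1.hasSum.sub s2.hasSum).sub s3'.hasSum).add s4'.hasSum
  refine h2.summable.hasSum_iff.2 (h2.tsum_eq.trans (Eq.trans ?_ (h1.symm.trans h0)))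
  rw [← t2, ← t3]
  rfl

lemma mul_sum_Icc_eq_diagonal_add_off_diagonal {s : ℕ} (hs : 1 ≤ s) (m n : ℕ) :
    ((if n < 2 * m then (-1 : ℝ) ^ n else 0) -
        if n < m then (1 + (-1 : ℝ) ^ m) * (-1) ^ n + (-1) ^ m else 0) *
        ∑ j ∈ Icc 2 (s + 1), 1 / ((m : ℝ) ^ j * (n : ℝ) ^ (s + 2 - j)) =
    (if m = n then (-1 : ℝ) ^ n * (s / (m : ℝ) ^ (s + 2)) else 0) +
      ((if m < n ∧ n < 2 * m then (-1 : ℝ) ^ n / (m * (n - m)) else 0) / (m : ℝ) ^ s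
      - (if m < n ∧ n < 2 * m then (-1 : ℝ) ^ n / (m * (n - m)) else 0) / (n : ℝ) ^ s
      - (if n < m then (-1 : ℝ) ^ m * ((-1) ^ n + 1) / (m * (m - n)) else 0) / (n : ℝ) ^ s
      + (if 0 < n ∧ n < m then
        (-1 : ℝ) ^ m * ((-1) ^ n + 1) / (m * (m - n)) else 0) / (m : ℝ) ^ s) := by
  rcases Nat.eq_zero_or_pos m with rfl | hm
  · simp
  rcases Nat.eq_zero_or_pos n with rfl | hn
  · rw [sum_eq_zero]
    · simp [show s ≠ 0 by lia, hm.ne']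
    · intro j hj
      rw [mem_Icc] at hj
      simp [show s + 2 - j ≠ 0 by lia]
  have hm0 : (m : ℝ) ≠ 0 := by positivity
  have hn0 : (n : ℝ) ≠ 0 := by positivity
  rcases eq_or_ne m n with rfl | hmn
  · have : ∑ j ∈ Icc 2 (s + 1), 1 / ((m : ℝ) ^ j * (m : ℝ) ^ (s + 2 - j)) =
        s / (m : ℝ) ^ (s + 2) := by
      rw [sum_congr rfl (g := fun _ => 1 / (m : ℝ) ^ (s + 2))]
      · simp [div_eq_mul_inv]
      · intro j hj
        rw [mem_Icc] at hj
        rw [← pow_add, show j + (s + 2 - j) = s + 2 by lia]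
    rw [this, if_pos (by lia)]
    simp
  have hmn' : (m : ℝ) ≠ n := by exact_mod_cast hmn
  have hd : (m : ℝ) - n ≠ 0 := sub_ne_zero.2 hmn'
  have hd' : (n : ℝ) - m ≠ 0 := sub_ne_zero.2 hmn'.symm
  rw [sum_Icc_one_div_pow_mul_pow s hm0 hn0 hmn', if_neg hmn]
  rcases hmn.lt_or_gt with h | h
  · by_cases h2 : n < 2 * m
    · simp only [h, h2, h.not_gt, and_self, and_false, if_true, if_false]
      rw [show (m : ℝ) - n = -(n - m) by ring]
      field_simp
      ring
    · simp [h2, h.not_gt]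
  · simp only [h, show n < 2 * m by lia, h.not_gt, hn, and_self, false_and, if_true, if_false]
    field_simp
    ring

end

theorem weighted_sum_formula_level2_case01 (k : ℕ) (hk : 3 ≤ k) :
    ∑ j ∈ Finset.Icc 2 (k - 1), ((2 : ℝ) ^ (j - 1) - 1) * altDoubleZeta 0 1 j (k - j)
      + ∑ j ∈ Finset.Icc 2 (k - 1), ((2 : ℝ) ^ (j - 1) - 1) * altDoubleZeta 1 1 j (k - j)
      - ∑ j ∈ Finset.Icc 2 (k - 1), altDoubleZeta 1 0 j (k - j)
      = ((k : ℝ) - 2) * altSingleZeta 1 k := by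
  obtain ⟨s, rfl⟩ : ∃ s, k = s + 2 := ⟨k - 2, by lia⟩
  rw [show s + 2 - 1 = s + 1 by lia, ← Finset.sum_add_distrib, ← Finset.sum_sub_distrib]
  have h1 := hasSum_sum (s := Finset.Icc 2 (s + 1)) fun j hj =>
    hasSum_weighted_altDoubleZeta (j := j) (l := s + 2 - j) (Finset.mem_Icc.1 hj).1
      (by rw [Finset.mem_Icc] at hj; lia)
  have h2 := (hasSum_diagonal (k := s + 2) (by lia) s).add (hasSum_off_diagonal (s := s) (by lia))
  rw [add_zero] at h2
  rw [show ((s + 2 : ℕ) : ℝ) - 2 = s by push_cast; ring]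
  refine h1.unique (h2.congr_fun ?_)
  rintro ⟨m, n⟩
  rw [← Finset.mul_sum]
  exact mul_sum_Icc_eq_diagonal_add_off_diagonal (by lia) m n
end

section
/- For every integer k ≥ 3, Σ_{j=2}^{k−1} 2^{j} ζ^{(2)}(\overline{j}, k−j) = (k−1) ζ(k) + 2 ζ^{(2)}(\overline{k}). -/
open Filter Topology

/-- The indices `m > n > 0` of a double series, parametrized by `n = x + 1` and
`m - n = y + 1`. -/
def gapEquiv : ℕ × ℕ ≃ {p : ℕ × ℕ // p.2 < p.1 ∧ 0 < p.2} where
  toFun z := ⟨(z.1 + 1 + (z.2 + 1), z.1 + 1), by constructor <;> simp⟩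
  invFun p := (p.1.2 - 1, p.1.1 - p.1.2 - 1)
  left_inv z := by ext <;> simp
  right_inv p := by
    obtain ⟨⟨m, n⟩, h1, h2⟩ := p
    simp only at h1 h2
    simp only [Subtype.mk.injEq, Prod.mk.injEq]
    omega

theorem altDoubleZeta_eq_tsum_prod (a b j l : ℕ) :
    altDoubleZeta a b j l = ∑' z : ℕ × ℕ,
      (-1 : ℝ) ^ (a * (z.1 + 1 + (z.2 + 1)) + b * (z.1 + 1)) /
        (((z.1 : ℝ) + 1 + (z.2 + 1)) ^ j * ((z.1 : ℝ) + 1) ^ l) := by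
  rw [altDoubleZeta, ← gapEquiv.tsum_eq]
  simp [gapEquiv]

theorem altSingleZeta_eq_tsum_nat (a k : ℕ) :
    altSingleZeta a k = ∑' x : ℕ, (-1 : ℝ) ^ (a * (x + 1)) / ((x : ℝ) + 1) ^ k := by
  change ∑' m : ℕ+, (-1 : ℝ) ^ (a * (m : ℕ)) / ((m : ℕ) : ℝ) ^ k = _
  rw [← Equiv.pnatEquivNat.symm.tsum_eq]
  simp [Equiv.pnatEquivNat, Nat.succPNat, Nat.succ_eq_add_one]

theorem summable_nat_succ_inv_pow {k : ℕ} (hk : 2 ≤ k) :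
    Summable fun x : ℕ => 1 / ((x : ℝ) + 1) ^ k := by
  have := (summable_nat_add_iff 1).2 (Real.summable_one_div_nat_pow.2 hk)
  simpa using this

/-- The odd function `z ↦ (-1) ^ z / z` on `ℤ`, equal to `0` at `0`. -/
noncomputable def altRecip (z : ℤ) : ℝ := (-1 : ℝ) ^ z / z

theorem altRecip_neg (z : ℤ) : altRecip (-z) = -altRecip z := by
  have : (-1 : ℝ) ^ (-z) = (-1) ^ z := by rw [zpow_neg, ← inv_zpow]; norm_num
  simp [altRecip, this, div_neg]

theorem tendsto_altRecip_add (a : ℤ) :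
    Tendsto (fun N : ℕ => altRecip (N + a)) atTop (𝓝 0) := by
  rw [tendsto_zero_iff_abs_tendsto_zero]
  have h : Tendsto (fun N : ℕ => |((N : ℝ) + a)|⁻¹) atTop (𝓝 0) :=
    tendsto_inv_atTop_zero.comp
      (tendsto_abs_atTop_atTop.comp
        (tendsto_atTop_add_const_right _ _ tendsto_natCast_atTop_atTop))
  refine h.congr fun N => ?_
  simp [altRecip, abs_div, abs_zpow]

theorem tendsto_sum_altRecip_sub (n : ℕ) :
    Tendsto (fun N : ℕ => ∑ y ∈ Finset.range N,
      (altRecip ((y : ℤ) + 1 - n) - altRecip ((y : ℤ) + 1 + n))) atTop (𝓝 (altRecip n)) := by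
  induction n with
  | zero => simp [altRecip]
  | succ n ih =>
    have h1 := tendsto_altRecip_add (-(n : ℤ))
    have h2 := tendsto_altRecip_add ((n : ℤ) + 1)
    have h3 := ih.add (((tendsto_const_nhds (x := altRecip (-(n : ℤ)))).sub h1).add
      ((tendsto_const_nhds (x := altRecip ((n : ℤ) + 1))).sub h2))
    have hlim : altRecip n + (altRecip (-(n : ℤ)) - 0 + (altRecip ((n : ℤ) + 1) - 0))
        = altRecip ((n + 1 : ℕ) : ℤ) := by
      rw [altRecip_neg]; push_cast; ring
    rw [hlim] at h3
    refine h3.congr fun N => ?_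
    have t1 := Finset.sum_range_sub' (fun y : ℕ => altRecip ((y : ℤ) + -n)) N
    have t2 := Finset.sum_range_sub' (fun y : ℕ => altRecip ((y : ℤ) + (n + 1))) N
    simp only [Nat.cast_zero, zero_add] at t1 t2
    rw [← t1, ← t2, ← Finset.sum_add_distrib, ← Finset.sum_add_distrib]
    refine Finset.sum_congr rfl fun y _ => ?_
    rw [show ((y : ℤ) + 1 - (n + 1 : ℕ)) = y + -n by push_cast; ring,
      show ((y : ℤ) + 1 + (n + 1 : ℕ)) = ((y + 1 : ℕ) : ℤ) + (n + 1) by push_cast; ring,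
      show (((y + 1 : ℕ) : ℤ) + -n) = (y : ℤ) + 1 - n by push_cast; ring,
      show ((y : ℤ) + (n + 1)) = (y : ℤ) + 1 + n by ring]
    ring

theorem summable_nat_succ_rpow : Summable fun x : ℕ => ((x : ℝ) + 1) ^ (-(3 / 2) : ℝ) := by
  have := (summable_nat_add_iff 1).2
    (Real.summable_nat_rpow (p := -(3 / 2)).2 (by norm_num))
  simpa using this

theorem summable_rpow_gap : Summable fun z : ℕ × ℕ =>
    ((z.1 : ℝ) + 1) ^ (-(3 / 2) : ℝ) * |(z.2 : ℝ) - z.1| ^ (-(3 / 2) : ℝ) := by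
  have h2 : Summable fun r : ℤ => |(r : ℝ)| ^ (-(3 / 2) : ℝ) :=
    Real.summable_abs_int_rpow (b := 3 / 2) (by norm_num)
  have h3 := summable_nat_succ_rpow.mul_of_nonneg h2 (fun _ => by positivity) (fun _ => by positivity)
  have hinj : Function.Injective fun z : ℕ × ℕ => (z.1, (z.2 : ℤ) - z.1) := by
    rintro ⟨x, y⟩ ⟨x', y'⟩ h
    simp only [Prod.mk.injEq] at h ⊢
    omega
  simpa [Function.comp_def] using h3.comp_injective hinj

theorem inv_mul_le_rpow_mul_rpow {n r m : ℝ} (hn : 0 < n) (hr : 0 ≤ r) (hnm : n ≤ m)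
    (hrm : r ≤ m) : 1 / (n * (m * r)) ≤ n ^ (-(3 / 2) : ℝ) * r ^ (-(3 / 2) : ℝ) := by
  rcases hr.eq_or_lt with rfl | hr
  · simp [Real.zero_rpow]
  have hm : 0 < m := hn.trans_le hnm
  have key : n ^ (1 / 2 : ℝ) * r ^ (1 / 2 : ℝ) ≤ m := by
    calc n ^ (1 / 2 : ℝ) * r ^ (1 / 2 : ℝ) ≤ m ^ (1 / 2 : ℝ) * m ^ (1 / 2 : ℝ) := by gcongr
      _ = m := by rw [← Real.rpow_add hm]; norm_num
  have e : ∀ t : ℝ, 0 < t → t ^ (-(3 / 2) : ℝ) = 1 / (t * t ^ (1 / 2 : ℝ)) := by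
    intro t ht
    rw [Real.rpow_neg ht.le, show (3 / 2 : ℝ) = 1 + 1 / 2 by norm_num, Real.rpow_add ht,
      Real.rpow_one, one_div (t * _)]
  rw [e n hn, e r hr, one_div_mul_one_div]
  apply one_div_le_one_div_of_le (by positivity)
  calc n * n ^ (1 / 2 : ℝ) * (r * r ^ (1 / 2 : ℝ))
      = n * ((n ^ (1 / 2 : ℝ) * r ^ (1 / 2 : ℝ)) * r) := by ring
    _ ≤ n * (m * r) := by gcongr

theorem summable_inv_mul_gap : Summable fun z : ℕ × ℕ =>
    1 / (((z.1 : ℝ) + 1) * (((z.1 : ℝ) + 1 + (z.2 + 1)) * |(z.2 : ℝ) - z.1|)) := by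
  refine Summable.of_nonneg_of_le (fun z => by positivity) (fun z => ?_) summable_rpow_gap
  have h1 : (0 : ℝ) ≤ z.1 := by positivity
  have h2 : (0 : ℝ) ≤ z.2 := by positivity
  refine inv_mul_le_rpow_mul_rpow (by positivity) (abs_nonneg _) (by linarith) ?_
  rw [abs_le]
  constructor <;> linarith

theorem summable_altDoubleZeta_term (a b : ℕ) {j l : ℕ} (hj : 2 ≤ j) (hl : 1 ≤ l) :
    Summable fun z : ℕ × ℕ => (-1 : ℝ) ^ (a * (z.1 + 1 + (z.2 + 1)) + b * (z.1 + 1)) /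
        (((z.1 : ℝ) + 1 + (z.2 + 1)) ^ j * ((z.1 : ℝ) + 1) ^ l) := by
  have h0 := summable_nat_succ_rpow
  refine Summable.of_norm_bounded
    (h0.mul_of_nonneg h0 (fun _ => by positivity) (fun _ => by positivity)) fun z => ?_
  obtain ⟨x, y⟩ := z
  have hx : (0 : ℝ) ≤ x := by positivity
  have hy : (0 : ℝ) ≤ y := by positivity
  simp only [norm_div, norm_pow, norm_neg, norm_one, one_pow, norm_mul, Real.norm_eq_abs]
  rw [abs_of_nonneg (by positivity : (0 : ℝ) ≤ (x : ℝ) + 1 + (y + 1)),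
    abs_of_nonneg (by positivity : (0 : ℝ) ≤ (x : ℝ) + 1)]
  refine le_trans ?_ (inv_mul_le_rpow_mul_rpow (m := (x : ℝ) + 1 + (y + 1))
    (by positivity) (by positivity) (by linarith) (by linarith))
  apply one_div_le_one_div_of_le (by positivity)
  calc ((x : ℝ) + 1) * (((x : ℝ) + 1 + (y + 1)) * (y + 1))
      ≤ ((x : ℝ) + 1) * (((x : ℝ) + 1 + (y + 1)) * ((x : ℝ) + 1 + (y + 1))) := by
        have : (y : ℝ) + 1 ≤ x + 1 + (y + 1) := by linarith
        exact mul_le_mul_of_nonneg_left (mul_le_mul_of_nonneg_left this (by positivity))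
          (by positivity)
    _ = ((x : ℝ) + 1 + (y + 1)) ^ 2 * ((x : ℝ) + 1) ^ 1 := by ring
    _ ≤ ((x : ℝ) + 1 + (y + 1)) ^ j * ((x : ℝ) + 1) ^ l := by
        gcongr <;> linarith

/-- The part of the weighted sum that is antisymmetric under `n ↔ m - n`. -/
noncomputable def skewPart (q : ℕ) (z : ℕ × ℕ) : ℝ :=
  (-1 : ℝ) ^ (z.1 + 1 + (z.2 + 1)) *
    (4 / (((z.1 : ℝ) + 1 + (z.2 + 1)) * ((z.1 : ℝ) - z.2))) *
      (2 / ((z.1 : ℝ) + 1 + (z.2 + 1))) ^ q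

/-- The part of the weighted sum that telescopes in `m` for fixed `n`. -/
noncomputable def telescopingPart (q : ℕ) (z : ℕ × ℕ) : ℝ :=
  (-1 : ℝ) ^ (z.1 + 1 + (z.2 + 1)) *
    (4 / (((z.1 : ℝ) + 1 + (z.2 + 1)) * ((z.2 : ℝ) - z.1))) * (1 / ((z.1 : ℝ) + 1)) ^ q

theorem sum_weighted_terms (q : ℕ) (z : ℕ × ℕ) :
    ∑ t ∈ Finset.range q, (2 : ℝ) ^ (t + 2) *
        ((-1 : ℝ) ^ (1 * (z.1 + 1 + (z.2 + 1)) + 0 * (z.1 + 1)) /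
        (((z.1 : ℝ) + 1 + (z.2 + 1)) ^ (t + 2) * ((z.1 : ℝ) + 1) ^ (q - t)))
      = skewPart q z + telescopingPart q z +
        if z.2 = z.1 then (q : ℝ) / ((z.1 : ℝ) + 1) ^ (q + 2) else 0 := by
  obtain ⟨x, y⟩ := z
  simp only [skewPart, telescopingPart, one_mul, zero_mul, add_zero]
  set s : ℝ := (-1 : ℝ) ^ (x + 1 + (y + 1)) with hs
  set m : ℝ := (x : ℝ) + 1 + (y + 1) with hm
  set n : ℝ := (x : ℝ) + 1 with hn
  have hm0 : 0 < m := by positivity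
  have hn0 : 0 < n := by positivity
  have hsum : ∑ t ∈ Finset.range q, (2 : ℝ) ^ (t + 2) * (s / (m ^ (t + 2) * n ^ (q - t)))
      = s * ((2 / m) ^ 2 * (1 / n)) *
        ∑ t ∈ Finset.range q, (2 / m) ^ t * (1 / n) ^ (q - 1 - t) := by
    rw [Finset.mul_sum]
    refine Finset.sum_congr rfl fun t ht => ?_
    obtain ⟨c, rfl⟩ : ∃ c, q = t + 1 + c := Nat.exists_eq_add_of_lt (Finset.mem_range.1 ht) |>.imp
      fun c h => by omega
    rw [show t + 1 + c - t = c + 1 by omega, show t + 1 + c - 1 - t = c by omega]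
    simp only [div_pow, one_pow]
    field_simp
    ring
  rw [hsum]
  by_cases hxy : y = x
  · subst hxy
    have h2 : 2 / m = 1 / n := by rw [hm, hn]; field_simp; ring
    have hs1 : s = 1 := by rw [hs, ← two_mul]; simp
    have hg : ∑ t ∈ Finset.range q, (1 / n) ^ t * (1 / n) ^ (q - 1 - t)
        = q * (1 / n) ^ (q - 1) := by
      rw [geom_sum₂_self]
    rw [h2, hg, hs1]
    rcases q with _ | q
    · simp
    · simp
      field_simp
      ring
  · have hne : (x : ℝ) - y ≠ 0 := sub_ne_zero.2 fun h => hxy (by exact_mod_cast h.symm)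
    have hne' : (y : ℝ) - x ≠ 0 := sub_ne_zero.2 fun h => hxy (by exact_mod_cast h)
    have hd : 2 / m - 1 / n = ((x : ℝ) - y) / (m * n) := by
      field_simp; rw [hm, hn]; ring
    have hg := geom_sum₂_mul (2 / m) (1 / n) q
    rw [hd] at hg
    rw [if_neg hxy, add_zero, show (y : ℝ) - x = -((x : ℝ) - y) by ring]
    set G := ∑ t ∈ Finset.range q, (2 / m) ^ t * (1 / n) ^ (q - 1 - t)
    have hG : G = ((2 / m) ^ q - (1 / n) ^ q) * ((m * n) / ((x : ℝ) - y)) := by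
      rw [← hg]; field_simp
    rw [hG]
    generalize (2 / m) ^ q = A
    generalize (1 / n) ^ q = B
    field_simp
    ring

theorem summable_skewPart {q : ℕ} (hq : 1 ≤ q) : Summable (skewPart q) := by
  refine Summable.of_norm_bounded (summable_inv_mul_gap.mul_left (4 * 2 ^ q)) fun z => ?_
  obtain ⟨x, y⟩ := z
  have hx : (0 : ℝ) ≤ x := by positivity
  have hy : (0 : ℝ) ≤ y := by positivity
  simp only [skewPart, norm_mul, norm_div, norm_pow, norm_neg, norm_one, one_pow,
    Real.norm_eq_abs, one_mul]
  rw [abs_sub_comm (x : ℝ) y, abs_of_nonneg (by positivity : (0 : ℝ) ≤ (x : ℝ) + 1 + (y + 1))]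
  have h : ((x : ℝ) + 1) ≤ ((x : ℝ) + 1 + (y + 1)) ^ q :=
    le_trans (by linarith) (le_self_pow₀ (by linarith) (by omega))
  have h' : 1 / ((x : ℝ) + 1 + (y + 1)) ^ q ≤ 1 / ((x : ℝ) + 1) :=
    one_div_le_one_div_of_le (by positivity) h
  calc _ = 4 * 2 ^ q * (1 / (((x : ℝ) + 1 + (y + 1)) * |(y : ℝ) - x|)) *
        (1 / ((x : ℝ) + 1 + (y + 1)) ^ q) := by
        simp only [Nat.abs_ofNat, div_pow]; ring
    _ ≤ 4 * 2 ^ q * (1 / (((x : ℝ) + 1 + (y + 1)) * |(y : ℝ) - x|)) *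
        (1 / ((x : ℝ) + 1)) := by gcongr
    _ = _ := by rw [mul_assoc, one_div_mul_one_div]; ring

theorem summable_telescopingPart {q : ℕ} (hq : 1 ≤ q) : Summable (telescopingPart q) := by
  refine Summable.of_norm_bounded (summable_inv_mul_gap.mul_left 4) fun z => ?_
  obtain ⟨x, y⟩ := z
  have hx : (0 : ℝ) ≤ x := by positivity
  have hy : (0 : ℝ) ≤ y := by positivity
  simp only [telescopingPart, norm_mul, norm_div, norm_pow, norm_neg, norm_one, one_pow,
    Real.norm_eq_abs, one_mul]
  rw [abs_of_nonneg (by positivity : (0 : ℝ) ≤ (x : ℝ) + 1 + (y + 1)),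
    abs_of_nonneg (by positivity : (0 : ℝ) ≤ (x : ℝ) + 1)]
  have h : ((x : ℝ) + 1) ≤ ((x : ℝ) + 1) ^ q := le_self_pow₀ (by linarith) (by omega)
  have h' : 1 / ((x : ℝ) + 1) ^ q ≤ 1 / ((x : ℝ) + 1) :=
    one_div_le_one_div_of_le (by positivity) h
  calc _ = 4 * (1 / (((x : ℝ) + 1 + (y + 1)) * |(y : ℝ) - x|)) *
        (1 / ((x : ℝ) + 1) ^ q) := by
        simp only [Nat.abs_ofNat, div_pow, one_pow]; ring
    _ ≤ 4 * (1 / (((x : ℝ) + 1 + (y + 1)) * |(y : ℝ) - x|)) * (1 / ((x : ℝ) + 1)) := by gcongr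
    _ = _ := by rw [mul_assoc, one_div_mul_one_div]; ring

theorem tsum_skewPart (q : ℕ) : ∑' z, skewPart q z = 0 := by
  have h : ∑' z, skewPart q z = -∑' z, skewPart q z := by
    conv_lhs => rw [← (Equiv.prodComm ℕ ℕ).tsum_eq]
    rw [← tsum_neg]
    refine tsum_congr fun z => ?_
    simp only [skewPart, Equiv.prodComm_apply, Prod.fst_swap, Prod.snd_swap]
    rw [add_comm (z.2 + 1) (z.1 + 1), add_comm ((z.2 : ℝ) + 1) (z.1 + 1), ← neg_sub (z.1 : ℝ) z.2,
      mul_neg, div_neg]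
    ring
  linarith

theorem telescopingPart_eq (q x y : ℕ) :
    telescopingPart q (x, y) = 2 / ((x : ℝ) + 1) ^ (q + 1) *
        (altRecip ((y : ℤ) + 1 - (x + 1 : ℕ)) - altRecip ((y : ℤ) + 1 + (x + 1 : ℕ))) +
      if y = x then 1 / ((x : ℝ) + 1) ^ (q + 2) else 0 := by
  have hs : (-1 : ℝ) ^ ((y : ℤ) + 1 + (x + 1 : ℕ)) = (-1 : ℝ) ^ (x + 1 + (y + 1)) := by
    rw [← zpow_natCast]; congr 1; push_cast; ring
  have hs' : (-1 : ℝ) ^ ((y : ℤ) + 1 - (x + 1 : ℕ)) = (-1 : ℝ) ^ (x + 1 + (y + 1)) := by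
    rw [← hs, show (y : ℤ) + 1 + (x + 1 : ℕ) = ((y : ℤ) + 1 - (x + 1 : ℕ)) + 2 * (x + 1 : ℕ) by
      ring, zpow_add₀ (by norm_num) _ (2 * _), zpow_mul]
    norm_num
  simp only [telescopingPart, altRecip, hs, hs']
  by_cases hxy : y = x
  · subst hxy
    have : (-1 : ℝ) ^ (y + 1 + (y + 1)) = 1 := by rw [← two_mul]; simp
    simp [this]
    field_simp
    ring
  · have hne' : (y : ℝ) - x ≠ 0 := sub_ne_zero.2 fun h => hxy (by exact_mod_cast h)
    rw [if_neg hxy, add_zero]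
    push_cast
    rw [show (y : ℝ) + 1 - (x + 1) = y - x by ring,
      show (y : ℝ) + 1 + (x + 1) = x + 1 + (y + 1) by ring]
    generalize (-1 : ℝ) ^ (x + 1 + (y + 1)) = s
    have hm0 : (x : ℝ) + 1 + (y + 1) ≠ 0 := by positivity
    rw [div_pow, one_pow]
    field_simp
    ring

theorem tsum_telescopingPart_fiber {q : ℕ} (hq : 1 ≤ q) (x : ℕ) :
    ∑' y, telescopingPart q (x, y) = 2 * ((-1 : ℝ) ^ (1 * (x + 1)) / ((x : ℝ) + 1) ^ (q + 2)) +
      1 / ((x : ℝ) + 1) ^ (q + 2) := by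
  have hsum : Summable fun y => telescopingPart q (x, y) :=
    (summable_telescopingPart hq).prod_factor x
  have hd : HasSum (fun y : ℕ => if y = x then 1 / ((x : ℝ) + 1) ^ (q + 2) else 0)
      (1 / ((x : ℝ) + 1) ^ (q + 2)) := hasSum_ite_eq x _
  have ht := (tendsto_sum_altRecip_sub (x + 1)).const_mul (2 / ((x : ℝ) + 1) ^ (q + 1))
  have ht' := ht.add hd.tendsto_sum_nat
  have := tendsto_nhds_unique (hsum.hasSum.tendsto_sum_nat) (ht'.congr fun N => by
    rw [Finset.mul_sum, ← Finset.sum_add_distrib]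
    exact Finset.sum_congr rfl fun y _ => (telescopingPart_eq q x y).symm)
  rw [this, altRecip, zpow_natCast]
  push_cast
  field_simp
  ring

theorem weighted_sum_level2_barred_first (k : ℕ) (hk : 3 ≤ k) :
    ∑ j ∈ Finset.Icc 2 (k - 1), (2 : ℝ) ^ j * altDoubleZeta 1 0 j (k - j)
      = ((k : ℝ) - 1) * altSingleZeta 0 k + 2 * altSingleZeta 1 k := by
  obtain ⟨q, rfl⟩ : ∃ q, k = q + 2 := ⟨k - 2, by omega⟩
  have hq : 1 ≤ q := by omega
  have hterm : ∀ t ∈ Finset.range q, Summable fun z : ℕ × ℕ => (2 : ℝ) ^ (t + 2) *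
      ((-1 : ℝ) ^ (1 * (z.1 + 1 + (z.2 + 1)) + 0 * (z.1 + 1)) /
        (((z.1 : ℝ) + 1 + (z.2 + 1)) ^ (t + 2) * ((z.1 : ℝ) + 1) ^ (q - t))) := fun t ht =>
    (summable_altDoubleZeta_term 1 0 (by omega)
      (by have := Finset.mem_range.1 ht; omega)).mul_left _
  have hS := summable_skewPart hq
  have hT := summable_telescopingPart hq
  have hD : Summable fun z : ℕ × ℕ =>
      if z.2 = z.1 then (q : ℝ) / ((z.1 : ℝ) + 1) ^ (q + 2) else 0 :=
    (((summable_sum hterm).sub hS).sub hT).congr fun z => by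
      rw [sum_weighted_terms]; ring
  have hζ : Summable fun x : ℕ => 1 / ((x : ℝ) + 1) ^ (q + 2) :=
    summable_nat_succ_inv_pow (by omega)
  have hζ' : Summable fun x : ℕ => (-1 : ℝ) ^ (1 * (x + 1)) / ((x : ℝ) + 1) ^ (q + 2) :=
    Summable.of_norm_bounded hζ fun x => by
      simp only [norm_div, norm_pow, norm_neg, norm_one, one_pow, Real.norm_eq_abs]
      rw [abs_of_nonneg (by positivity)]
  have hDsum : ∑' z : ℕ × ℕ, (if z.2 = z.1 then (q : ℝ) / ((z.1 : ℝ) + 1) ^ (q + 2) else 0)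
      = q * ∑' x : ℕ, 1 / ((x : ℝ) + 1) ^ (q + 2) := by
    rw [hD.tsum_prod, ← tsum_mul_left]
    refine tsum_congr fun x => ?_
    simp only [tsum_ite_eq]
    ring
  have hTsum : ∑' z, telescopingPart q z
      = 2 * (∑' x : ℕ, (-1 : ℝ) ^ (1 * (x + 1)) / ((x : ℝ) + 1) ^ (q + 2)) +
        ∑' x : ℕ, 1 / ((x : ℝ) + 1) ^ (q + 2) := by
    rw [hT.tsum_prod, ← tsum_mul_left, ← (hζ'.mul_left 2).tsum_add hζ]
    exact tsum_congr fun x => tsum_telescopingPart_fiber hq x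
  have hreindex : ∑ j ∈ Finset.Icc 2 (q + 2 - 1), (2 : ℝ) ^ j * altDoubleZeta 1 0 j (q + 2 - j)
      = ∑ t ∈ Finset.range q, (2 : ℝ) ^ (t + 2) * altDoubleZeta 1 0 (t + 2) (q - t) := by
    rw [Finset.sum_bij' (fun j _ => j - 2) (fun t _ => t + 2)]
    · intro j hj; simp only [Finset.mem_Icc, Finset.mem_range] at hj ⊢; omega
    · intro t ht; simp only [Finset.mem_Icc, Finset.mem_range] at ht ⊢; omega
    · intro j hj; simp only [Finset.mem_Icc] at hj; omega
    · intro t _; omega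
    · intro j hj
      simp only [Finset.mem_Icc] at hj
      rw [show j - 2 + 2 = j by omega, show q - (j - 2) = q + 2 - j by omega]
  rw [hreindex, altSingleZeta_eq_tsum_nat, altSingleZeta_eq_tsum_nat]
  simp only [altDoubleZeta_eq_tsum_prod, ← tsum_mul_left]
  rw [← Summable.tsum_finsetSum hterm, tsum_congr (sum_weighted_terms q),
    (hS.add hT).tsum_add hD, hS.tsum_add hT, tsum_skewPart, hTsum, hDsum]
  simp only [zero_mul, pow_zero, tsum_mul_left]
  push_cast
  ring
end
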